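/- Let n be a nonnegative integer and a, b, c, d, e, p ∈ ℂ. Assume bc − p(a−p) ≠ 0 and set γ = p(a−p)(b+c−a)/(bc − p(a−p)). Assume the parameters are nondegenerate for the identity below. Then the terminating very-well-poised series ₉F₈(a, 1+a/2, b, c, d, e, a−p+1, p+1, −n; a/2, 1+a−b, 1+a−c, 1+a−d, 1+a−e, p, a−p, 1+a+n; 1) = ((1+a)_n (1+a−d−e)_n / ((1+a−d)_n (1+a−e)_n)) · ₅F₄(a−b−c, d, e, γ+1, −n; 1+a−b, 1+a−c, d+e−a−n, γ; 1). -/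

import Mathlib

/-- Rising factorial (Pochhammer symbol) `(a)ₖ = a(a+1)⋯(a+k−1)`. -/
noncomputable def poch (a : ℂ) (k : ℕ) : ℂ := (ascPochhammer ℂ k).eval a

/-- Terminating hypergeometric sum with numerator parameters `A` together with
the extra top parameter `-n`, denominator parameters `B`, and argument `x`. -/
noncomputable def hypTerm (A B : List ℂ) (n : ℕ) (x : ℂ) : ℂ :=
  ∑ k ∈ Finset.range (n + 1),
    ((A.map fun a => poch a k).prod * poch (-(n : ℂ)) k) /
      ((k.factorial : ℂ) * (B.map fun b => poch b k).prod) * x ^ k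

theorem poch_zero (a : ℂ) : poch a 0 = 1 := by simp [poch]

theorem poch_succ (a : ℂ) (k : ℕ) : poch a (k + 1) = poch a k * (a + k) := by
  simp [poch, ascPochhammer_succ_eval]

theorem poch_succ_left (a : ℂ) (k : ℕ) : poch a (k + 1) = a * poch (a + 1) k := by
  induction k with
  | zero => simp [poch_succ, poch_zero]
  | succ k ih => rw [poch_succ, ih, poch_succ]; push_cast; ring

theorem poch_add (a : ℂ) (m k : ℕ) : poch a (m + k) = poch a m * poch (a + m) k := by
  induction k with
  | zero => simp [poch_zero]
  | succ k ih => rw [← add_assoc, poch_succ, ih, poch_succ]; push_cast; ring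

theorem poch_ne_zero_of_le {a : ℂ} {k n : ℕ} (h : poch a n ≠ 0) (hk : k ≤ n) :
    poch a k ≠ 0 := by
  obtain ⟨m, rfl⟩ := Nat.exists_eq_add_of_le hk
  rw [poch_add] at h
  exact left_ne_zero_of_mul h

theorem poch_neg_natCast_of_lt {m k : ℕ} (h : m < k) : poch (-(m : ℂ)) k = 0 := by
  by_contra hne
  have := poch_ne_zero_of_le hne (Nat.succ_le_of_lt h)
  rw [poch_succ] at this
  simp at this

theorem poch_neg_natCast_add (j m : ℕ) :
    poch (-((j + m : ℕ) : ℂ)) j * m.factorial = (-1) ^ j * (j + m).factorial := by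
  induction j generalizing m with
  | zero => simp [poch_zero]
  | succ j ih =>
    have h := ih (m + 1)
    rw [show j + 1 + m = j + (m + 1) by ring, pow_succ, poch_succ]
    rw [Nat.factorial_succ] at h
    push_cast at h ⊢
    linear_combination -h

/-- Reversing the order of the factors of a rising factorial. -/
theorem poch_reflect (z : ℂ) (n : ℕ) : poch z n = (-1) ^ n * poch (1 - z - n) n := by
  induction n with
  | zero => simp [poch_zero]
  | succ n ih =>
    rw [poch_succ, ih, poch_succ_left, pow_succ,
      show 1 - z - ((n + 1 : ℕ) : ℂ) + 1 = 1 - z - n by push_cast; ring]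
    push_cast
    ring

/-- `(1 + z)ₖ / (z)ₖ = (z + k) / z`, with denominators cleared. -/
theorem mul_poch_one_add (z : ℂ) (k : ℕ) : z * poch (1 + z) k = poch z k * (z + k) := by
  rw [add_comm 1 z, ← poch_succ_left, poch_succ]

/-- Contiguous relation for the partial sums of a balanced `₃F₂`. -/
theorem saalschutz_partial_sum (s β κ x y : ℂ) (hxy : x + y = 1 + s + β - κ) (M : ℕ)
    (hx : poch x M ≠ 0) (hy : poch y M ≠ 0) :
    ∑ j ∈ Finset.range (M + 1), poch s j * poch (-κ) j * poch β j /
        (j.factorial * (poch x j * poch y j)) =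
      (x - s) * (y - s) / (x * y) *
        ∑ j ∈ Finset.range M, poch s j * poch (1 - κ) j * poch (β + 1) j /
          (j.factorial * (poch (x + 1) j * poch (y + 1) j)) +
      poch s M * poch (1 - κ) M * poch (β + 1) M / (M.factorial * (poch x M * poch y M)) := by
  induction M with
  | zero => simp [poch_zero]
  | succ M ih =>
    have hx' := poch_ne_zero_of_le hx M.le_succ
    have hy' := poch_ne_zero_of_le hy M.le_succ
    rw [Finset.sum_range_succ, ih hx' hy', Finset.sum_range_succ _ M]
    have ex := poch_succ_left x M
    have ey := poch_succ_left y M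
    rw [ex] at hx
    rw [ey] at hy
    have hx0 := left_ne_zero_of_mul hx
    have hy0 := left_ne_zero_of_mul hy
    have hx1 := right_ne_zero_of_mul hx
    have hy1 := right_ne_zero_of_mul hy
    have hM : (M.factorial : ℂ) ≠ 0 := by exact_mod_cast M.factorial_ne_zero
    have hM1 : (M : ℂ) + 1 ≠ 0 := by exact_mod_cast M.succ_ne_zero
    have ex1 : poch x M * (x + M) = x * poch (x + 1) M := by rw [← poch_succ, ex]
    have ey1 : poch y M * (y + M) = y * poch (y + 1) M := by rw [← poch_succ, ey]
    have hxM : x + M ≠ 0 := right_ne_zero_of_mul (ex1 ▸ hx)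
    have hyM : y + M ≠ 0 := right_ne_zero_of_mul (ey1 ▸ hy)
    have fx : poch (x + 1) M = poch x M * (x + M) / x := by rw [ex1]; field_simp
    have fy : poch (y + 1) M = poch y M * (y + M) / y := by rw [ey1]; field_simp
    rw [mul_add, ex, ey, fx, fy, poch_succ s, poch_succ_left (-κ), poch_succ_left β,
      poch_succ (1 - κ), poch_succ (β + 1), Nat.factorial_succ,
      show -κ + 1 = 1 - κ by ring]
    obtain rfl : y = 1 + s + β - κ - x := by linear_combination hxy
    push_cast
    field_simp
    ring

/-- The Pfaff–Saalschütz summation, the sum being extended by vanishing terms. -/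
theorem saalschutz (k M : ℕ) (hk : k ≤ M) (a b c : ℂ)
    (hb : poch (1 + a - b) M ≠ 0) (hc : poch (1 + a - c) M ≠ 0) :
    ∑ j ∈ Finset.range (M + 1), poch (1 + a - b - c) j * poch (-(k : ℂ)) j * poch (a + k) j /
        (j.factorial * (poch (1 + a - b) j * poch (1 + a - c) j)) =
      poch b k * poch c k / (poch (1 + a - b) k * poch (1 + a - c) k) := by
  induction k generalizing M a b c with
  | zero =>
    rw [Finset.sum_range_succ']
    rw [Finset.sum_eq_zero]
    · simp [poch_zero]
    · intro j _
      rw [poch_neg_natCast_of_lt (Nat.succ_pos j)]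
      simp
  | succ k ih =>
    obtain ⟨L, rfl⟩ : ∃ L, M = L + 1 := ⟨M - 1, by omega⟩
    rw [saalschutz_partial_sum _ _ _ _ _ (by push_cast; ring) _ hb hc]
    have e : (1 : ℂ) - ((k + 1 : ℕ) : ℂ) = -(k : ℂ) := by push_cast; ring
    rw [e, poch_neg_natCast_of_lt (show k < L + 1 by omega)]
    rw [poch_succ_left] at hb hc
    have h := ih L (by omega) (a + 2) (b + 1) (c + 1)
      (by convert right_ne_zero_of_mul hb using 2; ring)
      (by convert right_ne_zero_of_mul hc using 2; ring)
    rw [show 1 + (a + 2) - (b + 1) - (c + 1) = 1 + a - b - c by ring,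
      show 1 + (a + 2) - (b + 1) = 1 + a - b + 1 by ring,
      show 1 + (a + 2) - (c + 1) = 1 + a - c + 1 by ring,
      show a + 2 + (k : ℂ) = a + ((k + 1 : ℕ) : ℂ) + 1 by push_cast; ring] at h
    rw [h]
    simp only [poch_succ_left _ k]
    rw [mul_zero, zero_mul, zero_div, add_zero, div_mul_div_comm]
    congr 1 <;> ring

/-- Contiguous relation for the partial sums of a very-well-poised `₅F₄`. -/
theorem wellPoised_partial_sum (A D E N : ℂ) (M : ℕ) (hD : poch (1 + A - D) M ≠ 0)
    (hE : poch (1 + A - E) M ≠ 0) (hN : poch (1 + A + N) M ≠ 0) :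
    ∑ m ∈ Finset.range (M + 1), (A + 2 * m) * poch A m * poch D m * poch E m * poch (-N) m /
        (m.factorial * (poch (1 + A - D) m * poch (1 + A - E) m * poch (1 + A + N) m)) =
      A * (A + 1) * (A - D - E + N) / ((1 + A - D) * (1 + A - E) * (1 + A + N)) *
        ∑ m ∈ Finset.range M, (A + 2 + 2 * m) * poch (A + 2) m * poch (D + 1) m *
            poch (E + 1) m * poch (1 - N) m /
          (m.factorial * (poch (1 + A - D + 1) m * poch (1 + A - E + 1) m *
            poch (1 + A + N + 1) m)) +
      poch A (M + 1) * poch (D + 1) M * poch (E + 1) M * poch (1 - N) M /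
        (M.factorial * (poch (1 + A - D) M * poch (1 + A - E) M * poch (1 + A + N) M)) := by
  induction M with
  | zero => simp [poch_zero, poch_succ]
  | succ M ih =>
    have hD' := poch_ne_zero_of_le hD M.le_succ
    have hE' := poch_ne_zero_of_le hE M.le_succ
    have hN' := poch_ne_zero_of_le hN M.le_succ
    rw [Finset.sum_range_succ, ih hD' hE' hN', Finset.sum_range_succ _ M]
    have shift : ∀ z : ℂ, poch z (M + 1) ≠ 0 →
        z ≠ 0 ∧ z + M ≠ 0 ∧ poch (z + 1) M = poch z M * (z + M) / z := by
      intro z hz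
      have h1 := hz
      rw [poch_succ] at hz
      rw [poch_succ_left] at h1
      have hz0 := left_ne_zero_of_mul h1
      refine ⟨hz0, right_ne_zero_of_mul hz, ?_⟩
      rw [← poch_succ, poch_succ_left]
      field_simp
    obtain ⟨hD0, hDM, fD⟩ := shift _ hD
    obtain ⟨hE0, hEM, fE⟩ := shift _ hE
    obtain ⟨hN0, hNM, fN⟩ := shift _ hN
    have hM : (M.factorial : ℂ) ≠ 0 := by exact_mod_cast M.factorial_ne_zero
    have hM1 : (M : ℂ) + 1 ≠ 0 := by exact_mod_cast M.succ_ne_zero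
    have fA : A * (A + 1) * poch (A + 2) M = poch A (M + 1) * (A + M + 1) := by
      have h := poch_succ A (M + 1)
      rw [poch_succ_left A (M + 1), poch_succ_left (A + 1) M,
        show A + 1 + 1 = A + 2 by ring] at h
      push_cast at h
      linear_combination h
    rw [mul_add (_ / _)]
    have key : A * (A + 1) * (A - D - E + N) / ((1 + A - D) * (1 + A - E) * (1 + A + N)) *
        ((A + 2 + 2 * M) * poch (A + 2) M * poch (D + 1) M * poch (E + 1) M * poch (1 - N) M /
          (M.factorial * (poch (1 + A - D + 1) M * poch (1 + A - E + 1) M *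
            poch (1 + A + N + 1) M))) =
        (poch A (M + 1) * (A + M + 1)) * (A - D - E + N) * (A + 2 + 2 * M) * poch (D + 1) M *
          poch (E + 1) M * poch (1 - N) M /
          (M.factorial * (poch (1 + A - D) M * (1 + A - D + M) *
            (poch (1 + A - E) M * (1 + A - E + M)) *
            (poch (1 + A + N) M * (1 + A + N + M)))) := by
      rw [← fA, fD, fE, fN]
      field_simp
    rw [key, poch_succ (1 + A - D), poch_succ (1 + A - E), poch_succ (1 + A + N),
      poch_succ A (M + 1), poch_succ_left D, poch_succ_left E, poch_succ_left (-N),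
      poch_succ (D + 1), poch_succ (E + 1), poch_succ (1 - N), Nat.factorial_succ,
      show -N + 1 = 1 - N by ring]
    push_cast
    field_simp
    ring

/-- The terminating very-well-poised `₅F₄` summation. -/
theorem wellPoised_sum (N : ℕ) (A D E : ℂ) (hD : poch (1 + A - D) N ≠ 0)
    (hE : poch (1 + A - E) N ≠ 0) (hN : poch (1 + A + N) N ≠ 0) :
    ∑ m ∈ Finset.range (N + 1),
      (A + 2 * m) * poch A m * poch D m * poch E m * poch (-(N : ℂ)) m /
        (m.factorial * (poch (1 + A - D) m * poch (1 + A - E) m * poch (1 + A + N) m)) =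
      poch A (N + 1) * poch (1 + A - D - E) N / (poch (1 + A - D) N * poch (1 + A - E) N) := by
  induction N generalizing A D E with
  | zero => simp [poch_zero, poch_succ]
  | succ N ih =>
    rw [wellPoised_partial_sum _ _ _ _ _ hD hE hN]
    have e : (1 : ℂ) - ((N + 1 : ℕ) : ℂ) = -(N : ℂ) := by push_cast; ring
    rw [e, poch_neg_natCast_of_lt N.lt_succ_self]
    rw [poch_succ_left] at hD hE hN
    have hN0 := left_ne_zero_of_mul hN
    have h := ih (A + 2) (D + 1) (E + 1)
      (by convert right_ne_zero_of_mul hD using 2; ring)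
      (by convert right_ne_zero_of_mul hE using 2; ring)
      (by convert right_ne_zero_of_mul hN using 2; push_cast; ring)
    rw [show 1 + (A + 2) - (D + 1) - (E + 1) = 1 + A - D - E by ring,
      show 1 + (A + 2) - (D + 1) = 1 + A - D + 1 by ring,
      show 1 + (A + 2) - (E + 1) = 1 + A - E + 1 by ring,
      show 1 + (A + 2) + (N : ℂ) = 1 + A + ((N + 1 : ℕ) : ℂ) + 1 by push_cast; ring] at h
    rw [h]
    have hA : A * (A + 1) * poch (A + 2) (N + 1) =
        poch A (N + 1 + 1) * (1 + A + ((N + 1 : ℕ) : ℂ)) := by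
      have h := poch_succ A (N + 1 + 1)
      rw [poch_succ_left A (N + 1 + 1), poch_succ_left (A + 1) (N + 1),
        show A + 1 + 1 = A + 2 by ring] at h
      push_cast at h ⊢
      linear_combination h
    rw [poch_succ_left (1 + A - D), poch_succ_left (1 + A - E), poch_succ (1 + A - D - E),
      mul_zero, zero_div, add_zero, div_mul_div_comm]
    have hD0 := left_ne_zero_of_mul hD
    have hE0 := left_ne_zero_of_mul hE
    have hD1 := right_ne_zero_of_mul hD
    have hE1 := right_ne_zero_of_mul hE
    rw [div_eq_div_iff (by positivity) (by positivity)]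
    push_cast at hA ⊢
    linear_combination (A - D - E + (N + 1)) * poch (1 + A - D - E) N *
      ((1 + A - D) * poch (1 + A - D + 1) N * ((1 + A - E) * poch (1 + A - E + 1) N)) * hA

/-- The sum of a very-well-poised `₅F₄` weighted by `(-k)ⱼ (a + k)ⱼ`. -/
theorem wellPoised_weighted_sum (n j : ℕ) (hj : j ≤ n) (a d e : ℂ) (ha : a ≠ 0)
    (hd : poch (1 + a - d) n ≠ 0) (he : poch (1 + a - e) n ≠ 0)
    (hn : poch (1 + a + n) n ≠ 0) (hde : poch (d + e - a - n) n ≠ 0) :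
    ∑ k ∈ Finset.range (n + 1),
      (a + 2 * k) / a * (poch a k * poch d k * poch e k * poch (-(n : ℂ)) k /
        (k.factorial * (poch (1 + a - d) k * poch (1 + a - e) k * poch (1 + a + n) k))) *
        (poch (-(k : ℂ)) j * poch (a + k) j) =
      poch (1 + a) n * poch (1 + a - d - e) n / (poch (1 + a - d) n * poch (1 + a - e) n) *
        (poch d j * poch e j * poch (-(n : ℂ)) j / poch (d + e - a - n) j) := by
  obtain ⟨N, rfl⟩ := Nat.exists_eq_add_of_le hj
  rw [add_assoc, Finset.sum_range_add, Finset.sum_eq_zero, zero_add]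
  swap
  · intro k hk
    rw [poch_neg_natCast_of_lt (Finset.mem_range.mp hk)]
    simp
  have hde' := poch_ne_zero_of_le hde hj
  have hrev : poch (1 + a - d - e) (j + N) =
      poch (1 + a - d - e) N * ((-1) ^ j * poch (d + e - a - ((j + N : ℕ) : ℂ)) j) := by
    rw [add_comm j N, poch_add, poch_reflect _ j]
    congr 3
    push_cast
    ring
  rw [poch_add (1 + a + _)] at hn
  rw [poch_add (1 + a - d)] at hd ⊢
  rw [poch_add (1 + a - e)] at he ⊢
  have hd0 := left_ne_zero_of_mul hd
  have hd1 := right_ne_zero_of_mul hd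
  have he0 := left_ne_zero_of_mul he
  have he1 := right_ne_zero_of_mul he
  have hn0 := left_ne_zero_of_mul hn
  have hn1 := right_ne_zero_of_mul hn
  have hS := wellPoised_sum N (a + 2 * j) (d + j) (e + j)
    (by convert hd1 using 2; ring) (by convert he1 using 2; ring)
    (by convert hn1 using 2; push_cast; ring)
  rw [show 1 + (a + 2 * j) - (d + j) - (e + j) = 1 + a - d - e by ring,
    show 1 + (a + 2 * j) - (d + j) = 1 + a - d + j by ring,
    show 1 + (a + 2 * j) - (e + j) = 1 + a - e + j by ring,
    show 1 + (a + 2 * j) + (N : ℂ) = 1 + a + ((j + N : ℕ) : ℂ) + j by push_cast; ring] at hS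
  have htop : poch a (j + j) * poch (a + 2 * j) (N + 1) =
      a * poch (1 + a) (j + N) * poch (1 + a + ((j + N : ℕ) : ℂ)) j := by
    have h := poch_add a (j + j) (N + 1)
    rw [show j + j + (N + 1) = (j + N) + j + 1 by ring, poch_succ_left, poch_add (a + 1),
      add_comm a 1] at h
    rw [show a + 2 * (j : ℂ) = a + ((j + j : ℕ) : ℂ) by push_cast; ring, ← h]
    ring
  trans (-1) ^ j * poch a (j + j) * poch d j * poch e j * poch (-((j + N : ℕ) : ℂ)) j /
      (a * (poch (1 + a - d) j * poch (1 + a - e) j * poch (1 + a + ((j + N : ℕ) : ℂ)) j)) *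
      (poch (a + 2 * j) (N + 1) * poch (1 + a - d - e) N /
        (poch (1 + a - d + j) N * poch (1 + a - e + j) N))
  · rw [← hS, Finset.mul_sum]
    refine Finset.sum_congr rfl fun m hm => ?_
    have hm' : m ≤ N := Nat.lt_succ_iff.mp (Finset.mem_range.mp hm)
    have hd2 := poch_ne_zero_of_le hd1 hm'
    have he2 := poch_ne_zero_of_le he1 hm'
    have hn2 := poch_ne_zero_of_le hn1 hm'
    have hf := poch_neg_natCast_add j m
    have hm0 : (m.factorial : ℂ) ≠ 0 := by exact_mod_cast m.factorial_ne_zero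
    have hjm : ((j + m).factorial : ℂ) ≠ 0 := by exact_mod_cast (j + m).factorial_ne_zero
    have hA : poch a (j + m) * poch (a + ((j + m : ℕ) : ℂ)) j =
        poch a (j + j) * poch (a + 2 * j) m := by
      rw [← poch_add, show j + m + j = j + j + m by ring, poch_add]
      congr 2
      push_cast
      ring
    have hf' : poch (-((j + m : ℕ) : ℂ)) j = (-1) ^ j * (j + m).factorial / m.factorial := by
      rw [← hf]; field_simp
    rw [poch_add d, poch_add e, poch_add (-((j + N : ℕ) : ℂ)), poch_add (1 + a - d),
      poch_add (1 + a - e), poch_add (1 + a + _), hf',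
      show -((j + N : ℕ) : ℂ) + j = -(N : ℂ) by push_cast; ring]
    field_simp
    push_cast at hA ⊢
    linear_combination (a + 2 * (j + m)) * poch d j * poch (d + j) m * poch e j *
      poch (e + j) m * poch (-(j + N : ℂ)) j * poch (-(N : ℂ)) m * hA
  · rw [hrev]
    field_simp
    linear_combination poch d j * poch e j * poch (-((j + N : ℕ) : ℂ)) j *
      poch (1 + a - d - e) N * htop

/-- A balanced-type `₄F₃` summation with one numerator parameter exceeding a denominator
parameter by one; here `q = 1 / (p (a - p))` and `r = 1 / γ`. -/
theorem saalschutz_extended (k n : ℕ) (hk : k ≤ n) (a b c q r : ℂ)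
    (hr : r * (a - b - c) = 1 - b * c * q) (hσ : a - b - c ≠ 0)
    (hb : poch (1 + a - b) n ≠ 0) (hc : poch (1 + a - c) n ≠ 0) :
    ∑ j ∈ Finset.range (n + 1), poch (a - b - c) j * (1 + j * r) /
        (j.factorial * (poch (1 + a - b) j * poch (1 + a - c) j)) *
        (poch (-(k : ℂ)) j * poch (a + k) j) =
      (1 + k * (a + k) * q) *
        (poch b k * poch c k / (poch (1 + a - b) k * poch (1 + a - c) k)) := by
  obtain _ | k := k
  · rw [Finset.sum_range_succ', Finset.sum_eq_zero]
    · simp [poch_zero]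
    · intro j _
      rw [poch_neg_natCast_of_lt (Nat.succ_pos j)]
      simp
  obtain ⟨L, rfl⟩ : ∃ L, n = L + 1 := ⟨n - 1, by omega⟩
  have hS := saalschutz (k + 1) (L + 1) hk a b c hb hc
  rw [poch_succ_left] at hb hc
  have hb0 := left_ne_zero_of_mul hb
  have hc0 := left_ne_zero_of_mul hc
  have hb1 := right_ne_zero_of_mul hb
  have hc1 := right_ne_zero_of_mul hc
  have hS' := saalschutz k L (by omega) (a + 2) (b + 1) (c + 1)
    (by convert hb1 using 2; ring) (by convert hc1 using 2; ring)
  rw [show 1 + (a + 2) - (b + 1) - (c + 1) = 1 + a - b - c by ring,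
    show 1 + (a + 2) - (b + 1) = 1 + a - b + 1 by ring,
    show 1 + (a + 2) - (c + 1) = 1 + a - c + 1 by ring,
    show a + 2 + (k : ℂ) = a + ((k + 1 : ℕ) : ℂ) + 1 by push_cast; ring] at hS'
  have hT : ∑ j ∈ Finset.range (L + 1 + 1), j * (poch (a - b - c) j / (a - b - c)) /
        (j.factorial * (poch (1 + a - b) j * poch (1 + a - c) j)) *
        (poch (-((k + 1 : ℕ) : ℂ)) j * poch (a + ((k + 1 : ℕ) : ℂ)) j) =
      -((k + 1 : ℕ) * (a + (k + 1 : ℕ))) / ((1 + a - b) * (1 + a - c)) *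
        (poch (b + 1) k * poch (c + 1) k /
          (poch (1 + a - b + 1) k * poch (1 + a - c + 1) k)) := by
    rw [Finset.sum_range_succ', ← hS', Finset.mul_sum]
    simp only [Nat.cast_zero, zero_mul, zero_div, add_zero]
    refine Finset.sum_congr rfl fun j _ => ?_
    have hj0 : (j : ℂ) + 1 ≠ 0 := by exact_mod_cast j.succ_ne_zero
    rw [poch_succ_left (a - b - c), poch_succ_left (1 + a - b), poch_succ_left (1 + a - c),
      poch_succ_left (-_), poch_succ_left (a + _), Nat.factorial_succ,
      show a - b - c + 1 = 1 + a - b - c by ring,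
      show -((k + 1 : ℕ) : ℂ) + 1 = -(k : ℂ) by push_cast; ring]
    push_cast
    field_simp
  have hsplit : ∀ j : ℕ, poch (a - b - c) j * (1 + j * r) =
      poch (1 + a - b - c) j - b * c * q * (j * (poch (a - b - c) j / (a - b - c))) := by
    intro j
    have h := mul_poch_one_add (a - b - c) j
    rw [show 1 + (a - b - c) = 1 + a - b - c by ring] at h
    field_simp
    linear_combination poch (a - b - c) j * j * hr - h
  trans ∑ j ∈ Finset.range (L + 1 + 1), poch (1 + a - b - c) j *
        poch (-((k + 1 : ℕ) : ℂ)) j * poch (a + ((k + 1 : ℕ) : ℂ)) j /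
        (j.factorial * (poch (1 + a - b) j * poch (1 + a - c) j)) -
      b * c * q * ∑ j ∈ Finset.range (L + 1 + 1), j * (poch (a - b - c) j / (a - b - c)) /
        (j.factorial * (poch (1 + a - b) j * poch (1 + a - c) j)) *
        (poch (-((k + 1 : ℕ) : ℂ)) j * poch (a + ((k + 1 : ℕ) : ℂ)) j)
  · rw [Finset.mul_sum, ← Finset.sum_sub_distrib]
    refine Finset.sum_congr rfl fun j _ => ?_
    rw [hsplit]
    ring
  · rw [hS, hT]
    simp only [poch_succ_left _ k]
    have hb2 := poch_ne_zero_of_le hb1 (show k ≤ L by omega)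
    have hc2 := poch_ne_zero_of_le hc1 (show k ≤ L by omega)
    field_simp
    ring

theorem svf_9F8_to_5F4 (n : ℕ) (a b c d e p : ℂ)
    (hbc : b * c - p * (a - p) ≠ 0) (γ : ℂ)
    (hγ : γ = p * (a - p) * (b + c - a) / (b * c - p * (a - p)))
    (hnd : ∀ z ∈ [a / 2, 1 + a - b, 1 + a - c, 1 + a - d, 1 + a - e, p, a - p,
        1 + a + (n : ℂ), d + e - a - (n : ℂ), γ],
      ∀ k ≤ n, poch z k ≠ 0) :
    hypTerm [a, 1 + a / 2, b, c, d, e, a - p + 1, p + 1]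
        [a / 2, 1 + a - b, 1 + a - c, 1 + a - d, 1 + a - e, p, a - p, 1 + a + (n : ℂ)] n 1
      = poch (1 + a) n * poch (1 + a - d - e) n / (poch (1 + a - d) n * poch (1 + a - e) n) *
        hypTerm [a - b - c, d, e, γ + 1]
          [1 + a - b, 1 + a - c, d + e - a - (n : ℂ), γ] n 1 := by
  obtain rfl | hn := Nat.eq_zero_or_pos n
  · simp [hypTerm, poch_zero]
  simp only [List.mem_cons, List.not_mem_nil, or_false, forall_eq_or_imp, forall_eq] at hnd
  obtain ⟨ha2, hb, hc, hd, he, hp, hap, han, hde, hγn⟩ := hnd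
  have ne_zero : ∀ z : ℂ, (∀ k ≤ n, poch z k ≠ 0) → z ≠ 0 := fun z h => by
    simpa [poch_succ, poch_zero] using h 1 hn
  have ha0 : a ≠ 0 := fun h => ne_zero _ ha2 (by simp [h])
  have hp0 := ne_zero _ hp
  have hap0 := ne_zero _ hap
  have hγ0 := ne_zero _ hγn
  have hσ : a - b - c ≠ 0 := fun h => hγ0 (by
    rw [hγ, show b + c - a = 0 by linear_combination -h]; simp)
  have hr : γ⁻¹ * (a - b - c) = 1 - b * c * (1 / (p * (a - p))) := by
    have hσ' : b + c - a ≠ 0 := fun h => hσ (by linear_combination -h)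
    rw [hγ]
    field_simp
    ring
  have hleft : hypTerm [a, 1 + a / 2, b, c, d, e, a - p + 1, p + 1]
        [a / 2, 1 + a - b, 1 + a - c, 1 + a - d, 1 + a - e, p, a - p, 1 + a + (n : ℂ)] n 1 =
      ∑ k ∈ Finset.range (n + 1), ∑ j ∈ Finset.range (n + 1),
        (a + 2 * k) / a * (poch a k * poch d k * poch e k * poch (-(n : ℂ)) k /
          (k.factorial * (poch (1 + a - d) k * poch (1 + a - e) k * poch (1 + a + n) k))) *
        (poch (a - b - c) j * (1 + j * γ⁻¹) /
          (j.factorial * (poch (1 + a - b) j * poch (1 + a - c) j)) *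
          (poch (-(k : ℂ)) j * poch (a + k) j)) := by
    refine Finset.sum_congr rfl fun k hk => ?_
    have hkn : k ≤ n := Nat.lt_succ_iff.mp (Finset.mem_range.mp hk)
    rw [← Finset.mul_sum, saalschutz_extended k n hkn a b c _ _ hr hσ (hb n le_rfl) (hc n le_rfl)]
    simp only [List.map_cons, List.map_nil, List.prod_cons, List.prod_nil, mul_one, one_pow]
    have h1 : poch (1 + a / 2) k = poch (a / 2) k * (a + 2 * k) / a := by
      have := mul_poch_one_add (a / 2) k
      field_simp at this ⊢
      linear_combination this
    have h2 : poch (p + 1) k = poch p k * (p + k) / p := by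
      rw [← mul_poch_one_add, add_comm]; field_simp
    have h3 : poch (a - p + 1) k = poch (a - p) k * (a - p + k) / (a - p) := by
      rw [← mul_poch_one_add, add_comm]; field_simp
    rw [h1, h2, h3]
    have hu := ha2 k hkn
    have hv := hp k hkn
    have hw := hap k hkn
    have hcancel : (a + 2 * k) / a * (1 + k * (a + k) * (1 / (p * (a - p)))) =
        poch (a / 2) k * (a + 2 * k) / a * (poch (a - p) k * (a - p + k) / (a - p)) *
          (poch p k * (p + k) / p) / (poch (a / 2) k * poch p k * poch (a - p) k) := by
      generalize poch (a / 2) k = u at *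
      generalize poch p k = v at *
      generalize poch (a - p) k = w at *
      field_simp
      ring
    linear_combination -(poch a k * poch d k * poch e k * poch (-(n : ℂ)) k /
      (k.factorial * (poch (1 + a - d) k * poch (1 + a - e) k * poch (1 + a + n) k)) *
      (poch b k * poch c k / (poch (1 + a - b) k * poch (1 + a - c) k))) * hcancel
  rw [hleft, Finset.sum_comm, hypTerm, Finset.mul_sum]
  refine Finset.sum_congr rfl fun j hj => ?_
  have hjn : j ≤ n := Nat.lt_succ_iff.mp (Finset.mem_range.mp hj)
  have hγj : poch (γ + 1) j = poch γ j * (1 + j * γ⁻¹) := by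
    have h := mul_poch_one_add γ j
    rw [add_comm] at h
    field_simp
    linear_combination h
  have hγj0 := hγn j hjn
  simp only [List.map_cons, List.map_nil, List.prod_cons, List.prod_nil, mul_one, one_pow]
  trans poch (a - b - c) j * (1 + j * γ⁻¹) /
      (j.factorial * (poch (1 + a - b) j * poch (1 + a - c) j)) *
      (poch (1 + a) n * poch (1 + a - d - e) n / (poch (1 + a - d) n * poch (1 + a - e) n) *
        (poch d j * poch e j * poch (-(n : ℂ)) j / poch (d + e - a - n) j))
  · rw [← wellPoised_weighted_sum n j hjn a d e ha0 (hd n le_rfl) (he n le_rfl) (han n le_rfl)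
      (hde n le_rfl), Finset.mul_sum]
    exact Finset.sum_congr rfl fun k _ => by ring
  · rw [hγj]
    linear_combination -(poch (a - b - c) j * (1 + j * γ⁻¹) /
      (j.factorial * (poch (1 + a - b) j * poch (1 + a - c) j)) *
      (poch (1 + a) n * poch (1 + a - d - e) n / (poch (1 + a - d) n * poch (1 + a - e) n) *
        (poch d j * poch e j * poch (-(n : ℂ)) j / poch (d + e - a - n) j))) *
      mul_inv_cancel₀ hγj0
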